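/- Fix n ≥ 1, a covariate matrix X ∈ ℝ^{n×d}, group labels Z ∈ {1,…,H}ⁿ, a measurable function f₀ : ℝᵈ → ℝ, σ₀ > 0, and a known positive definite matrix Σ ∈ ℝ^{n×n}, and suppose Y = f₀(X) + ε with ε ~ N(0, σ₀²·Σ). Suppose the design is exactly balanced: the multiset {X_i : Z_i = h} is the same for every group h = 1,…,H; let r ≤ n/H be the number of distinct covariate values, and assume the r×r kernel matrix of the r distinct covariate values is nonsingular (equivalently, rank(K_n) = r). Then for any permutation size b with 1 ≤ b ≤ n − r, any test statistic T, and covariance matrix Σ, both the discrete and the continuous partial permutation p-values with covariance matrix Σ are valid: Pr(p(X,Y,Z,Σ) ≤ α) ≤ α for every α ∈ (0,1). -/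

import Mathlib

open MeasureTheory ProbabilityTheory Filter

noncomputable section

namespace PPT

/-- The law of `k` i.i.d. standard Gaussian random variables. -/
def stdGaussianPi (k : ℕ) : Measure (Fin k → ℝ) :=
  Measure.pi fun _ => gaussianReal 0 1

/-- The law of `n` i.i.d. centered Gaussian noises with standard deviation `σ`. -/
def noiseLaw (n : ℕ) (σ : ℝ) : Measure (Fin n → ℝ) :=
  Measure.pi fun _ => gaussianReal 0 ((σ ^ 2).toNNReal)

/-- Matrix (given as a function) times vector. -/
def mulVecF {n m : ℕ} (A : Fin n → Fin m → ℝ) (v : Fin m → ℝ) : Fin n → ℝ :=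
  fun i => ∑ j, A i j * v j

/-- Transposed matrix times vector, `Aᵀ v`. -/
def tmulVecF {n : ℕ} (A : Fin n → Fin n → ℝ) (v : Fin n → ℝ) : Fin n → ℝ :=
  fun i => ∑ j, A j i * v j

/-- Matrix product of matrices given as functions. -/
def mulF {n : ℕ} (A B : Fin n → Fin n → ℝ) : Fin n → Fin n → ℝ :=
  fun i j => ∑ k, A i k * B k j

/-- The identity matrix as a function. -/
def idF (n : ℕ) : Fin n → Fin n → ℝ :=
  fun i j => if i = j then 1 else 0

/-- Quadratic form `vᵀ A v`. -/
def quadForm {n : ℕ} (A : Fin n → Fin n → ℝ) (v : Fin n → ℝ) : ℝ :=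
  ∑ i, ∑ j, v i * A i j * v j

/-- `A` is an orthogonal matrix: `A Aᵀ = I`. -/
def IsOrthogonalF {n : ℕ} (A : Fin n → Fin n → ℝ) : Prop :=
  ∀ i j, (∑ k, A i k * A j k) = if i = j then (1 : ℝ) else 0

/-- `(Γ, c)` is an eigendecomposition `Kmat = Γ diag(c) Γᵀ` of `Kmat`, with `Γ` orthogonal and
the eigenvalues `c` nonnegative and in nonincreasing order. -/
def IsEigenDecomp {n : ℕ} (Kmat Γ : Fin n → Fin n → ℝ) (c : Fin n → ℝ) : Prop :=
  IsOrthogonalF Γ ∧ (∀ i j, Kmat i j = ∑ k, Γ i k * c k * Γ j k) ∧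
    (∀ i j : Fin n, i ≤ j → c j ≤ c i) ∧ (∀ i, 0 ≤ c i)

/-- A symmetric positive semidefinite kernel on `ℝᵈ`. -/
def IsPSDKernel {d : ℕ} (K : (Fin d → ℝ) → (Fin d → ℝ) → ℝ) : Prop :=
  (∀ x y, K x y = K y x) ∧
    ∀ (m : ℕ) (v : Fin m → (Fin d → ℝ)) (a : Fin m → ℝ),
      0 ≤ ∑ i, ∑ j, a i * a j * K (v i) (v j)

/-- The set `M(n,b)` of permutations of `{0, …, n-1}` keeping the first `n - b` elements fixed. -/
def permSet (n b : ℕ) : Finset (Equiv.Perm (Fin n)) :=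
  Finset.univ.filter fun ψ => ∀ i : Fin n, (i : ℕ) < n - b → ψ i = i

/-- The discrete partial permutation p-value, with covariates `X`, group labels `Z`,
test statistic `T`, eigenvector matrix `Γ`, permutation size `b` and responses `Y`. -/
def pDisc {n d H : ℕ} (X : Fin n → Fin d → ℝ) (Z : Fin n → Fin H)
    (T : (Fin n → Fin d → ℝ) → (Fin n → ℝ) → (Fin n → Fin H) → ℝ)
    (Γ : Fin n → Fin n → ℝ) (b : ℕ) (Y : Fin n → ℝ) : ℝ :=
  ((permSet n b).card : ℝ)⁻¹ *
    ∑ ψ ∈ permSet n b,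
      if T X Y Z ≤ T X (mulVecF Γ ((tmulVecF Γ Y) ∘ ψ)) Z then 1 else 0

/-- Squared norm of the last `b` coordinates of a vector in `ℝⁿ`. -/
def tailNormSq {n : ℕ} (b : ℕ) (w : Fin n → ℝ) : ℝ :=
  ∑ i ∈ Finset.univ.filter (fun i : Fin n => n - b ≤ (i : ℕ)), w i ^ 2

/-- The continuous partial permutation of `w` driven by `g`: it agrees with `w` on the first
`n - b` coordinates, and its last `b` coordinates are those of `g` rescaled to lie on the sphere
of radius `(Σ_{i ≥ n-b} w i ^ 2)^{1/2}`.  When `g` is standard Gaussian, the last `b` coordinates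
are uniformly distributed on that sphere. -/
def wStar {n : ℕ} (b : ℕ) (w g : Fin n → ℝ) : Fin n → ℝ := fun i =>
  if (i : ℕ) < n - b then w i
  else Real.sqrt (tailNormSq b w) * g i / Real.sqrt (tailNormSq b g)

/-- The continuous partial permutation p-value. -/
def pCont {n d H : ℕ} (X : Fin n → Fin d → ℝ) (Z : Fin n → Fin H)
    (T : (Fin n → Fin d → ℝ) → (Fin n → ℝ) → (Fin n → Fin H) → ℝ)
    (Γ : Fin n → Fin n → ℝ) (b : ℕ) (Y : Fin n → ℝ) : ℝ :=
  (stdGaussianPi n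
    {g | T X Y Z ≤ T X (mulVecF Γ (wStar b (tmulVecF Γ Y) g)) Z}).toReal

/-- The chi-squared distribution with `k` degrees of freedom, realized as the law of the sum of
squares of `k` independent standard Gaussians. -/
def chiSq (k : ℕ) : Measure ℝ :=
  Measure.map (fun g : Fin k → ℝ => ∑ i, g i ^ 2) (stdGaussianPi k)

/-- The quantile function of the chi-squared distribution with `k` degrees of freedom. -/
def chiSqQuantile (k : ℕ) (p : ℝ) : ℝ :=
  sInf {x : ℝ | ENNReal.ofReal p ≤ chiSq k (Set.Iic x)}

end PPT

namespace PPT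

/-- A square matrix (as a function) is symmetric. -/
def IsSymmF {n : ℕ} (A : Fin n → Fin n → ℝ) : Prop := ∀ i j, A i j = A j i

/-- A square matrix (as a function) is symmetric positive definite. -/
def IsPosDefF {n : ℕ} (A : Fin n → Fin n → ℝ) : Prop :=
  IsSymmF A ∧ ∀ v : Fin n → ℝ, v ≠ 0 → 0 < quadForm A v

/-- `(Sh, R)` is the pair `(Σ^{1/2}, Σ^{-1/2})` associated with the positive definite matrix
`Sm`: `Sh` is the symmetric positive definite square root of `Sm` and `R` is its inverse. -/
def IsSqrtPair {n : ℕ} (Sm Sh R : Fin n → Fin n → ℝ) : Prop :=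
  IsPosDefF Sh ∧ mulF Sh Sh = Sm ∧ mulF R Sh = idF n ∧ mulF Sh R = idF n

end PPT


lemma pval_real (l : Measure ℝ) [IsProbabilityMeasure l] (a : ENNReal) :
    MeasurableSet {x | l (Set.Ici x) ≤ a} ∧ l {x | l (Set.Ici x) ≤ a} ≤ a := by
  have hup : IsUpperSet {x | l (Set.Ici x) ≤ a} := by
    intro x y hxy hx
    exact (measure_mono (Set.Ici_subset_Ici.2 hxy)).trans hx
  have hm : MeasurableSet {x | l (Set.Ici x) ≤ a} := hup.ordConnected.measurableSet
  refine ⟨hm, ?_⟩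
  rw [hm.measure_eq_iSup_isCompact]
  refine iSup_le fun Kk => iSup_le fun hK => iSup_le fun hc => ?_
  rcases Kk.eq_empty_or_nonempty with rfl | hne
  · simp
  obtain ⟨x, hx, hmin⟩ := hc.exists_isLeast hne
  exact (measure_mono (fun y hy => hmin hy)).trans (hK hx)

lemma pval_one {E : Type*} [MeasurableSpace E] (ν : Measure E) [IsProbabilityMeasure ν]
    (S : E → ℝ) (hS : Measurable S) (a : ENNReal) :
    ν {w | ν {w' | S w ≤ S w'} ≤ a} ≤ a := by
  have : IsProbabilityMeasure (ν.map S) := Measure.isProbabilityMeasure_map hS.aemeasurable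
  obtain ⟨h1, h2⟩ := pval_real (ν.map S) a
  rw [Measure.map_apply hS h1] at h2
  refine le_trans (measure_mono ?_) h2
  intro w hw
  simp only [Set.mem_preimage, Set.mem_ofPred_eq]
  rw [Measure.map_apply hS measurableSet_Ici]
  exact hw

lemma pval_abs {E Θ : Type*} [MeasurableSpace E] [MeasurableSpace Θ]
    (ν : Measure E) [IsProbabilityMeasure ν] (ρ : Measure Θ) [IsProbabilityMeasure ρ]
    (φ : E → Θ → E) (hinv : MeasurePreserving (Function.uncurry φ) (ν.prod ρ) ν)
    (hcons : ∀ w, ∀ᵐ θ ∂ρ, ρ.map (φ (φ w θ)) = ρ.map (φ w))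
    (S : E → ℝ) (hS : Measurable S) (α : ℝ) (hα : 0 < α) :
    MeasurableSet {w | (ρ {θ | S w ≤ S (φ w θ)}).toReal ≤ α} ∧
    ν {w | (ρ {θ | S w ≤ S (φ w θ)}).toReal ≤ α} ≤ ENNReal.ofReal α := by
  have hφ := hinv.measurable
  have hφ1 : ∀ w, Measurable (φ w) := fun w => hφ.comp measurable_prodMk_left
  have hm : MeasurableSet {w | (ρ {θ | S w ≤ S (φ w θ)}).toReal ≤ α} := by
    refine measurableSet_le ?_ measurable_const
    refine ENNReal.measurable_toReal.comp ?_
    exact measurable_measure_prodMk_left (ν := ρ)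
      (s := {p : E × Θ | S p.1 ≤ S (φ p.1 p.2)})
      (measurableSet_le (hS.comp measurable_fst) (hS.comp hφ))
  refine ⟨hm, ?_⟩
  rw [← hinv.measure_preimage hm.nullMeasurableSet, Measure.prod_apply (hφ hm)]
  have key : ∀ w, ρ (Prod.mk w ⁻¹' (Function.uncurry φ ⁻¹'
      {w | (ρ {θ | S w ≤ S (φ w θ)}).toReal ≤ α})) ≤ ENNReal.ofReal α := by
    intro w
    have : IsProbabilityMeasure (ρ.map (φ w)) :=
      Measure.isProbabilityMeasure_map (hφ1 w).aemeasurable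
    have h := pval_one (ρ.map (φ w)) S hS (ENNReal.ofReal α)
    refine le_trans ?_ ((Measure.le_map_apply (hφ1 w).aemeasurable _).trans h)
    refine measure_mono_ae ?_
    filter_upwards [hcons w] with θ hθ hle
    change (ρ {θ' | S (φ w θ) ≤ S (φ (φ w θ) θ')}).toReal ≤ α at hle
    change (ρ.map (φ w)) {w' | S (φ w θ) ≤ S w'} ≤ ENNReal.ofReal α
    rw [← hθ, Measure.map_apply (hφ1 _) (measurableSet_le measurable_const hS)]
    exact (ENNReal.le_ofReal_iff_toReal_le (measure_ne_top _ _) hα.le).2 hle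
  calc _ ≤ ∫⁻ _, ENNReal.ofReal α ∂ν := lintegral_mono key
    _ = _ := by simp

lemma kap_inv {E : Type*} [NormedAddCommGroup E] [InnerProductSpace ℝ E] [FiniteDimensional ℝ E]
    [MeasurableSpace E] [BorelSpace E] (x y : E) (h : ‖x‖ = ‖y‖) :
    ∫ z, Complex.exp (((inner ℝ (‖z‖⁻¹ • z) x : ℝ) : ℂ) * Complex.I) ∂(stdGaussian E) =
    ∫ z, Complex.exp (((inner ℝ (‖z‖⁻¹ • z) y : ℝ) : ℂ) * Complex.I) ∂(stdGaussian E) := by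
  let f := Submodule.reflection (Submodule.span ℝ {x - y})ᗮ
  have hf : f x = y := Submodule.reflection_sub h
  have hmp : (stdGaussian E).map f = stdGaussian E := stdGaussian_map f
  conv_rhs => rw [← hmp]
  rw [integral_map f.continuous.aemeasurable (by
    refine Measurable.aestronglyMeasurable ?_
    fun_prop)]
  refine integral_congr_ae (ae_of_all _ fun z => ?_)
  simp only [LinearIsometryEquiv.norm_map]
  rw [← hf, ← map_smul, LinearIsometryEquiv.inner_map_map]

lemma polar_law {E : Type*} [NormedAddCommGroup E] [InnerProductSpace ℝ E] [FiniteDimensional ℝ E]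
    [MeasurableSpace E] [BorelSpace E] (hne : ∀ᵐ z ∂(stdGaussian E), z ≠ 0) :
    MeasurePreserving (fun p : E × E => ‖p.1‖ • (‖p.2‖⁻¹ • p.2))
      ((stdGaussian E).prod (stdGaussian E)) (stdGaussian E) := by
  have hmeas : Measurable (fun p : E × E => ‖p.1‖ • (‖p.2‖⁻¹ • p.2)) := by fun_prop
  refine ⟨hmeas, ?_⟩
  have : IsProbabilityMeasure (((stdGaussian E).prod (stdGaussian E)).map
    (fun p : E × E => ‖p.1‖ • (‖p.2‖⁻¹ • p.2))) :=
    Measure.isProbabilityMeasure_map hmeas.aemeasurable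
  apply Measure.ext_of_charFun
  ext t
  rw [charFun_apply, integral_map hmeas.aemeasurable (by
    refine Measurable.aestronglyMeasurable ?_
    fun_prop)]
  have hint : ∀ F : E × E → ℝ, Measurable F → Integrable (fun p => Complex.exp ((F p : ℂ) * Complex.I))
      ((stdGaussian E).prod (stdGaussian E)) := by
    intro F hF
    refine Integrable.of_bound (C := 1) (Measurable.aestronglyMeasurable ?_) (ae_of_all _ fun p => ?_)
    · fun_prop
    · rw [Complex.norm_exp_ofReal_mul_I]
  rw [integral_prod _ (hint (fun p => inner ℝ (‖p.1‖ • (‖p.2‖⁻¹ • p.2)) t) (by fun_prop))]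
  -- LHS = ∫ g, κ (‖g‖ • t)
  have e1 : ∀ g : E, ∫ z, Complex.exp (((inner ℝ (‖g‖ • (‖z‖⁻¹ • z)) t : ℝ) : ℂ) * Complex.I)
      ∂(stdGaussian E) =
      ∫ z, Complex.exp (((inner ℝ (‖z‖⁻¹ • z) (‖t‖ • g) : ℝ) : ℂ) * Complex.I) ∂(stdGaussian E) := by
    intro g
    rw [← kap_inv (‖g‖ • t) (‖t‖ • g) (by simp [norm_smul, mul_comm])]
    refine integral_congr_ae (ae_of_all _ fun z => ?_)
    simp only [inner_smul_left, inner_smul_right]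
    simp
  simp only [e1]
  rw [integral_integral_swap (f := fun g z => Complex.exp
    (((inner ℝ (‖z‖⁻¹ • z) (‖t‖ • g) : ℝ) : ℂ) * Complex.I))
    (hint (fun p => inner ℝ (‖p.2‖⁻¹ • p.2) (‖t‖ • p.1)) (by fun_prop))]
  have e2 : ∀ᵐ z ∂(stdGaussian E), ∫ g, Complex.exp
      (((inner ℝ (‖z‖⁻¹ • z) (‖t‖ • g) : ℝ) : ℂ) * Complex.I) ∂(stdGaussian E) =
      charFun (stdGaussian E) t := by
    filter_upwards [hne] with z hz
    have hz' : ‖z‖ ≠ 0 := norm_ne_zero_iff.2 hz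
    have : charFun (stdGaussian E) t = charFun (stdGaussian E) (‖t‖ • (‖z‖⁻¹ • z)) := by
      rw [charFun_stdGaussian, charFun_stdGaussian]
      simp [norm_smul, hz']
    rw [this, charFun_apply]
    refine integral_congr_ae (ae_of_all _ fun g => ?_)
    simp only [inner_smul_left, inner_smul_right, real_inner_comm g z]
    simp
  rw [integral_congr_ae e2]
  simp

namespace PPT

instance (k : ℕ) : IsProbabilityMeasure (stdGaussianPi k) := by
  unfold stdGaussianPi; infer_instance

/-- Coordinates of a standard Gaussian vector are almost surely nonzero. -/
lemma ae_coord_ne {ι : Type*} [Fintype ι] (i : ι) :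
    ∀ᵐ z ∂(Measure.pi fun _ : ι => gaussianReal 0 1), z i ≠ 0 := by
  have hmp := measurePreserving_eval (fun _ : ι => gaussianReal 0 1) i
  have : NullSingletonClass (gaussianReal 0 1) := nullSingletonClass_gaussianReal one_ne_zero
  have h0 : ∀ᵐ x ∂(gaussianReal 0 1), x ≠ 0 := by
    rw [ae_iff]; simp
  exact hmp.quasiMeasurePreserving.ae h0

lemma measurePreserving_toLp {ι : Type*} [Fintype ι] :
    MeasurePreserving (WithLp.toLp 2) (Measure.pi fun _ : ι => gaussianReal 0 1)
      (stdGaussian (EuclideanSpace ℝ ι)) :=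
  ⟨by fun_prop, map_pi_eq_stdGaussian⟩

lemma measurePreserving_ofLp {ι : Type*} [Fintype ι] :
    MeasurePreserving (fun x : EuclideanSpace ℝ ι => (WithLp.ofLp x : ι → ℝ))
      (stdGaussian (EuclideanSpace ℝ ι)) (Measure.pi fun _ : ι => gaussianReal 0 1) := by
  refine ⟨by fun_prop, ?_⟩
  rw [← map_pi_eq_stdGaussian, Measure.map_map (by fun_prop) (by fun_prop)]
  exact Measure.map_id

lemma polar_pi {ι : Type*} [Fintype ι] [Nonempty ι] :
    MeasurePreserving (fun p : (ι → ℝ) × (ι → ℝ) => fun i =>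
      Real.sqrt (∑ j, p.1 j ^ 2) * p.2 i / Real.sqrt (∑ j, p.2 j ^ 2))
      ((Measure.pi fun _ : ι => gaussianReal 0 1).prod (Measure.pi fun _ : ι => gaussianReal 0 1))
      (Measure.pi fun _ : ι => gaussianReal 0 1) := by
  obtain ⟨i0⟩ := ‹Nonempty ι›
  have hne : ∀ᵐ z ∂(stdGaussian (EuclideanSpace ℝ ι)), z ≠ 0 := by
    have := measurePreserving_ofLp.quasiMeasurePreserving.ae (ae_coord_ne i0)
    filter_upwards [this] with z hz h
    simp [h] at hz
  have h := measurePreserving_ofLp.comp ((polar_law hne).comp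
    ((measurePreserving_toLp (ι := ι)).prod (measurePreserving_toLp (ι := ι))))
  convert h using 1
  ext p i
  simp [EuclideanSpace.norm_eq]
  ring

lemma tailNormSq_eq {n : ℕ} (b : ℕ) (w : Fin n → ℝ) :
    tailNormSq b w = ∑ i : {i : Fin n // ¬ ((i : ℕ) < n - b)}, w i ^ 2 := by
  unfold tailNormSq
  rw [Finset.sum_subtype (p := fun i : Fin n => ¬ ((i : ℕ) < n - b))]
  intro x
  simp

lemma wStar_inv {n : ℕ} (hn : 1 ≤ n) (b : ℕ) (hb : 1 ≤ b) :
    MeasurePreserving (Function.uncurry (wStar (n := n) b))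
      ((stdGaussianPi n).prod (stdGaussianPi n)) (stdGaussianPi n) := by
  let q : Fin n → Prop := fun i => (i : ℕ) < n - b
  have : Nonempty {i : Fin n // ¬ q i} := ⟨⟨⟨n - 1, by omega⟩, by simp [q]; omega⟩⟩
  have he := measurePreserving_piEquivPiSubtypeProd (fun _ : Fin n => gaussianReal 0 1) q
  have h1 := he.prod he
  let πA := Measure.pi fun _ : {i : Fin n // q i} => gaussianReal 0 1
  let πT := Measure.pi fun _ : {i : Fin n // ¬ q i} => gaussianReal 0 1
  have h2 : MeasurePreserving (Prod.map id Prod.snd) ((πA.prod πT).prod (πA.prod πT))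
      ((πA.prod πT).prod πT) := (MeasurePreserving.id _).prod measurePreserving_snd
  have h3 := measurePreserving_prodAssoc πA πT πT
  have h4 := (MeasurePreserving.id πA).prod (polar_pi (ι := {i : Fin n // ¬ q i}))
  have h5 := (he.symm).comp (h4.comp (h3.comp (h2.comp h1)))
  change MeasurePreserving _ ((Measure.pi fun _ => gaussianReal 0 1).prod
    (Measure.pi fun _ => gaussianReal 0 1)) (Measure.pi fun _ => gaussianReal 0 1)
  convert h5 using 1
  ext p i
  simp only [Function.uncurry, wStar, Function.comp, MeasurableEquiv.piEquivPiSubtypeProd,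
    tailNormSq_eq]
  by_cases hi : (i : ℕ) < n - b
  · simp [hi, q, Equiv.piEquivPiSubtypeProd, MeasurableEquiv.prodAssoc]
  · simp [hi, q, Equiv.piEquivPiSubtypeProd, MeasurableEquiv.prodAssoc]

lemma tailNormSq_nonneg {n : ℕ} (b : ℕ) (w : Fin n → ℝ) : 0 ≤ tailNormSq b w :=
  Finset.sum_nonneg fun _ _ => sq_nonneg _

lemma wStar_cons {n : ℕ} (hn : 1 ≤ n) (b : ℕ) (hb : 1 ≤ b) (w : Fin n → ℝ) :
    ∀ᵐ g ∂(stdGaussianPi n), (stdGaussianPi n).map (wStar b (wStar b w g)) =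
      (stdGaussianPi n).map (wStar b w) := by
  filter_upwards [ae_coord_ne (⟨n - 1, by omega⟩ : Fin n)] with g hg
  have hpos : 0 < tailNormSq b g := by
    have : g ⟨n - 1, by omega⟩ ^ 2 ≤ tailNormSq b g := by
      unfold tailNormSq
      refine Finset.single_le_sum (f := fun i => g i ^ 2) (fun _ _ => sq_nonneg _) ?_
      simp; omega
    have h2 : 0 < g ⟨n - 1, by omega⟩ ^ 2 := by positivity
    linarith
  have ht : tailNormSq b (wStar b w g) = tailNormSq b w := by
    have : tailNormSq b (wStar b w g) =
        tailNormSq b w / tailNormSq b g * tailNormSq b g := by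
      have e : ∀ t : ℝ, t * tailNormSq b g =
          ∑ i ∈ Finset.univ.filter (fun i : Fin n => n - b ≤ (i : ℕ)), t * g i ^ 2 := by
        intro t; rw [tailNormSq, Finset.mul_sum]
      rw [e]
      conv_lhs => rw [tailNormSq]
      refine Finset.sum_congr rfl fun i hi => ?_
      have hi' : ¬ (i : ℕ) < n - b := by simpa using hi
      simp only [wStar, hi', if_false]
      rw [div_pow, mul_pow, Real.sq_sqrt (tailNormSq_nonneg b w), Real.sq_sqrt hpos.le]
      ring
    rw [this]; field_simp
  congr 1
  ext g' i
  unfold wStar at ht ⊢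
  rw [ht]
  by_cases hi : (i : ℕ) < n - b <;> simp [hi]

lemma wStar_affine {n : ℕ} (b : ℕ) (σ : ℝ) (hσ : 0 < σ) (m : Fin n → ℝ)
    (hm : ∀ i : Fin n, n - b ≤ (i : ℕ) → m i = 0) (w g : Fin n → ℝ) :
    wStar b (fun i => m i + σ * w i) g = fun i => m i + σ * wStar b w g i := by
  have ht : tailNormSq b (fun i => m i + σ * w i) = σ ^ 2 * tailNormSq b w := by
    unfold tailNormSq
    rw [Finset.mul_sum]
    refine Finset.sum_congr rfl fun i hi => ?_
    simp only [hm i (by simpa using hi)]; ring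
  ext i
  unfold wStar
  rw [ht, Real.sqrt_mul (sq_nonneg _), Real.sqrt_sq hσ.le]
  by_cases hi : (i : ℕ) < n - b
  · simp [hi]
  · simp [hi, hm i (by omega)]; ring

lemma inv_affine {n : ℕ} {Θ : Type*} [MeasurableSpace Θ] (ρ : Measure Θ) [IsProbabilityMeasure ρ]
    (φ : (Fin n → ℝ) → Θ → (Fin n → ℝ))
    (hinv : MeasurePreserving (Function.uncurry φ) ((stdGaussianPi n).prod ρ) (stdGaussianPi n))
    (L : (Fin n → ℝ) → (Fin n → ℝ)) (hL : Measurable L)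
    (hφ : ∀ w θ, φ (L w) θ = L (φ w θ)) :
    MeasurePreserving (Function.uncurry φ) (((stdGaussianPi n).map L).prod ρ)
      ((stdGaussianPi n).map L) := by
  refine ⟨hinv.measurable, ?_⟩
  have h : ((stdGaussianPi n).map L).prod ρ =
      ((stdGaussianPi n).prod ρ).map (Prod.map L id) := by
    have := Measure.map_prod_map (stdGaussianPi n) ρ hL measurable_id
    rw [← this, Measure.map_id]
  rw [h, Measure.map_map hinv.measurable (by fun_prop)]
  have : Function.uncurry φ ∘ Prod.map L id = L ∘ Function.uncurry φ := by
    ext1 p; simp [Function.uncurry, hφ]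
  rw [this, ← Measure.map_map hL hinv.measurable, hinv.map_eq]

/-! Discrete case -/

lemma permSet_mem {n b : ℕ} {ψ : Equiv.Perm (Fin n)} :
    ψ ∈ permSet n b ↔ ∀ i : Fin n, (i : ℕ) < n - b → ψ i = i := by
  simp [permSet]

lemma permSet_mul {n b : ℕ} {ψ : Equiv.Perm (Fin n)} (hψ : ψ ∈ permSet n b)
    (θ : Equiv.Perm (Fin n)) : θ ∈ permSet n b ↔ ψ * θ ∈ permSet n b := by
  rw [permSet_mem] at *
  rw [permSet_mem]
  constructor
  · intro h i hi
    simp [h i hi, hψ i hi]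
  · intro h i hi
    apply ψ.injective
    rw [hψ i hi]; exact h i hi

instance (n b : ℕ) : MeasurableSpace {ψ // ψ ∈ permSet n b} := ⊤

instance (n b : ℕ) : MeasurableSingletonClass {ψ // ψ ∈ permSet n b} := ⟨fun _ => trivial⟩

instance (n b : ℕ) : Nonempty {ψ // ψ ∈ permSet n b} := ⟨⟨1, by simp [permSet]⟩⟩

/-- Uniform law on the set of partial permutations. -/
def permLaw (n b : ℕ) : Measure {ψ // ψ ∈ permSet n b} := uniformOn Set.univ

instance (n b : ℕ) : IsProbabilityMeasure (permLaw n b) :=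
  isProbabilityMeasure_uniformOn Set.finite_univ Set.univ_nonempty

/-- The action of partial permutations. -/
def permAct (n b : ℕ) (w : Fin n → ℝ) (ψ : {ψ // ψ ∈ permSet n b}) : Fin n → ℝ := w ∘ ψ.1

lemma permAct_inv (n b : ℕ) :
    MeasurePreserving (Function.uncurry (permAct n b)) ((stdGaussianPi n).prod (permLaw n b))
      (stdGaussianPi n) := by
  have hmp : ∀ ψ : Equiv.Perm (Fin n),
      MeasurePreserving (fun w : Fin n → ℝ => w ∘ ψ) (stdGaussianPi n) (stdGaussianPi n) := by
    intro ψ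
    have h := measurePreserving_piCongrLeft (fun _ : Fin n => gaussianReal 0 1) ψ
    exact h.symm
  have hmeas : Measurable (Function.uncurry (permAct n b)) := by
    refine measurable_from_prod_countable_left fun ψ => ?_
    exact (hmp ψ.1).measurable
  refine ⟨hmeas, ?_⟩
  ext s hs
  rw [Measure.map_apply hmeas hs, Measure.prod_apply_symm (hmeas hs)]
  have : ∀ ψ : {ψ // ψ ∈ permSet n b}, stdGaussianPi n
      ((fun w => (w, ψ)) ⁻¹' (Function.uncurry (permAct n b) ⁻¹' s)) = stdGaussianPi n s :=
    fun ψ => (hmp ψ.1).measure_preimage hs.nullMeasurableSet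
  simp [this]

lemma permAct_cons (n b : ℕ) (w : Fin n → ℝ) (θ : {ψ // ψ ∈ permSet n b}) :
    (permLaw n b).map (permAct n b (permAct n b w θ)) = (permLaw n b).map (permAct n b w) := by
  let e : {ψ // ψ ∈ permSet n b} ≃ {ψ // ψ ∈ permSet n b} :=
    (Equiv.mulLeft θ.1).subtypeEquiv (fun a => permSet_mul θ.2 a)
  have he : permAct n b (permAct n b w θ) = permAct n b w ∘ e := by
    rfl
  have htop : ∀ f : {ψ // ψ ∈ permSet n b} → (Fin n → ℝ), Measurable f :=
    fun f s _ => trivial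
  ext s hs
  rw [Measure.map_apply (htop _) hs, Measure.map_apply (htop _) hs, he, Set.preimage_comp]
  unfold permLaw
  rw [uniformOn_univ, uniformOn_univ, Measure.count_apply (MeasurableSpace.measurableSet_top),
    Measure.count_apply (MeasurableSpace.measurableSet_top),
    Set.encard_preimage_of_bijective e.bijective]

lemma permLaw_eq (n b : ℕ) (P : Equiv.Perm (Fin n) → Prop) [DecidablePred P] :
    (permLaw n b {ψ | P ψ.1}).toReal =
      ((permSet n b).card : ℝ)⁻¹ * ∑ ψ ∈ permSet n b, if P ψ then 1 else 0 := by
  have h : {ψ : {ψ // ψ ∈ permSet n b} | P ψ.1} =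
      ((Finset.univ.filter fun ψ : {ψ // ψ ∈ permSet n b} => P ψ.1 : Finset _) : Set _) := by
    ext; simp
  unfold permLaw
  rw [uniformOn_univ, h, Measure.count_apply_finset, Fintype.card_coe,
    ← Finset.sum_coe_sort (permSet n b), Finset.sum_boole]
  simp [div_eq_inv_mul]

lemma permAct_affine {n : ℕ} (b : ℕ) (σ : ℝ) (m : Fin n → ℝ)
    (hm : ∀ i : Fin n, n - b ≤ (i : ℕ) → m i = 0) (w : Fin n → ℝ) (ψ : {ψ // ψ ∈ permSet n b}) :
    permAct n b (fun i => m i + σ * w i) ψ = fun i => m i + σ * permAct n b w ψ i := by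
  have h := permSet_mem.1 ψ.2
  ext i
  simp only [permAct, Function.comp]
  congr 1
  by_cases hi : (i : ℕ) < n - b
  · rw [h i hi]
  · rw [hm i (by omega), hm]
    by_contra hc
    have := ψ.1.injective (h _ (not_le.1 hc))
    omega

/-! Orthogonal invariance -/

lemma orth_mul {n : ℕ} {Γ : Fin n → Fin n → ℝ} (hΓ : IsOrthogonalF Γ) :
    Matrix.of Γ * (Matrix.of Γ).transpose = 1 := by
  ext i j
  simp [Matrix.mul_apply, Matrix.one_apply, hΓ i j]

lemma tmul_inv {n : ℕ} {Γ : Fin n → Fin n → ℝ} (hΓ : IsOrthogonalF Γ) :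
    MeasurePreserving (tmulVecF Γ) (stdGaussianPi n) (stdGaussianPi n) := by
  have hn : ∀ v : EuclideanSpace ℝ (Fin n),
      ‖Matrix.toEuclideanLin (Matrix.of Γ).transpose v‖ = ‖v‖ := by
    intro v
    rw [← sq_eq_sq₀ (norm_nonneg _) (norm_nonneg _), EuclideanSpace.real_norm_sq_eq,
      EuclideanSpace.real_norm_sq_eq]
    have h : ((Matrix.of Γ).transpose.mulVec v.ofLp) ⬝ᵥ ((Matrix.of Γ).transpose.mulVec v.ofLp) =
        v.ofLp ⬝ᵥ v.ofLp := by
      rw [Matrix.dotProduct_mulVec, Matrix.vecMul_transpose, Matrix.mulVec_mulVec, orth_mul hΓ,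
        Matrix.one_mulVec]
    simpa [dotProduct, sq] using h
  let f : EuclideanSpace ℝ (Fin n) ≃ₗᵢ[ℝ] EuclideanSpace ℝ (Fin n) :=
    LinearIsometry.toLinearIsometryEquiv ⟨Matrix.toEuclideanLin (Matrix.of Γ).transpose, hn⟩ rfl
  have hf : MeasurePreserving f (stdGaussian (EuclideanSpace ℝ (Fin n)))
      (stdGaussian (EuclideanSpace ℝ (Fin n))) := ⟨f.continuous.measurable, stdGaussian_map f⟩
  have h := measurePreserving_ofLp.comp (hf.comp (measurePreserving_toLp (ι := Fin n)))
  exact h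

/-! Linear algebra -/

lemma eig_zero {n r : ℕ} {A Γ : Fin n → Fin n → ℝ} {c : Fin n → ℝ} (hE : IsEigenDecomp A Γ c)
    (hrank : (Matrix.of A).rank ≤ r) (i : Fin n) (hi : r ≤ (i : ℕ)) : c i = 0 := by
  obtain ⟨h1, h2, h3, h4⟩ := hE
  have hA : Matrix.of A = Matrix.of Γ * Matrix.diagonal c * (Matrix.of Γ).transpose := by
    ext i j
    rw [Matrix.mul_apply]
    simp [Matrix.mul_diagonal, h2 i j]
  have ho := orth_mul h1
  have ho' := mul_eq_one_comm.1 ho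
  have hD : Matrix.diagonal c = (Matrix.of Γ).transpose * Matrix.of A * Matrix.of Γ := by
    rw [hA]
    simp only [Matrix.mul_assoc, ho']
    rw [Matrix.mul_one, ← Matrix.mul_assoc, ho', Matrix.one_mul]
  have hr : (Matrix.diagonal c).rank ≤ r := by
    rw [hD]
    exact ((Matrix.rank_mul_le_left _ _).trans (Matrix.rank_mul_le_right _ _)).trans hrank
  rw [Matrix.rank_diagonal] at hr
  by_contra hne
  have hpos : 0 < c i := lt_of_le_of_ne (h4 i) (Ne.symm hne)
  have hcard : (i : ℕ) + 1 ≤ Fintype.card {j // c j ≠ 0} := by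
    rw [Fintype.card_subtype, ← Fin.card_Iic i]
    refine Finset.card_le_card fun j hj => ?_
    have := h3 j i (Finset.mem_Iic.1 hj)
    simp
    linarith
  omega

lemma mem_range {n d r : ℕ} (X : Fin n → Fin d → ℝ)
    (hr : r = Set.ncard (Set.range fun i => X i)) (f0 : (Fin d → ℝ) → ℝ)
    (K : (Fin d → ℝ) → (Fin d → ℝ) → ℝ) (Kn : Fin n → Fin n → ℝ)
    (hKn : ∀ i j, Kn i j = K (X i) (X j)) (hrank : (Matrix.of Kn).rank = r) :
    ∃ a : Fin n → ℝ, (Matrix.of Kn).mulVec a = fun i => f0 (X i) := by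
  classical
  let L : (Set.range X → ℝ) →ₗ[ℝ] (Fin n → ℝ) :=
    LinearMap.funLeft ℝ ℝ (Set.rangeFactorization X)
  have hle : LinearMap.range (Matrix.of Kn).mulVecLin ≤ LinearMap.range L := by
    rintro _ ⟨a, rfl⟩
    refine ⟨fun x => ∑ j, K x.1 (X j) * a j, ?_⟩
    ext i
    simp [L, LinearMap.funLeft_apply, Matrix.mulVec, dotProduct, hKn, Set.rangeFactorization]
  have hfin : Module.finrank ℝ (LinearMap.range L) ≤
      Module.finrank ℝ (LinearMap.range (Matrix.of Kn).mulVecLin) := by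
    change _ ≤ (Matrix.of Kn).rank
    rw [hrank, hr]
    refine (LinearMap.finrank_range_le L).trans ?_
    rw [Module.finrank_fintype_fun_eq_card]
    rw [← Nat.card_eq_fintype_card, Nat.card_coe_set_eq]
  have heq := Submodule.eq_of_le_of_finrank_le hle hfin
  have hmem : (fun i => f0 (X i)) ∈ LinearMap.range L := ⟨fun x => f0 x.1, rfl⟩
  rw [← heq] at hmem
  exact hmem

lemma mean_zero {n d r : ℕ} (X : Fin n → Fin d → ℝ)
    (hr : r = Set.ncard (Set.range fun i => X i)) (f0 : (Fin d → ℝ) → ℝ)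
    (K : (Fin d → ℝ) → (Fin d → ℝ) → ℝ) (Kn KnC Sh R Γ : Fin n → Fin n → ℝ) (c : Fin n → ℝ)
    (hKn : ∀ i j, Kn i j = K (X i) (X j)) (hrank : (Matrix.of Kn).rank = r)
    (hRS : mulF R Sh = idF n) (hKnC : KnC = mulF R (mulF Kn R))
    (hEig : IsEigenDecomp KnC Γ c) (i : Fin n) (hi : r ≤ (i : ℕ)) :
    tmulVecF Γ (mulVecF R fun i => f0 (X i)) i = 0 := by
  have hK : Matrix.of KnC = Matrix.of R * (Matrix.of Kn * Matrix.of R) := by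
    rw [hKnC]; rfl
  have hRS' : Matrix.of R * Matrix.of Sh = 1 := by
    have h : Matrix.of (mulF R Sh) = Matrix.of (idF n) := by rw [hRS]
    exact h.trans (by ext i j; simp [idF, Matrix.one_apply])
  have hrC : (Matrix.of KnC).rank ≤ r := by
    rw [hK, ← hrank]
    exact (Matrix.rank_mul_le_right _ _).trans (Matrix.rank_mul_le_left _ _)
  have hc := eig_zero hEig hrC i hi
  obtain ⟨a, ha⟩ := mem_range X hr f0 K Kn hKn hrank
  obtain ⟨h1, h2, -, -⟩ := hEig
  have hA : Matrix.of KnC = Matrix.of Γ * (Matrix.diagonal c * (Matrix.of Γ).transpose) := by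
    rw [← Matrix.mul_assoc]
    ext i j
    rw [Matrix.mul_apply]
    simp [Matrix.mul_diagonal, h2 i j]
  have ho' := mul_eq_one_comm.1 (orth_mul h1)
  change ((Matrix.of Γ).transpose.mulVec ((Matrix.of R).mulVec fun i => f0 (X i))) i = 0
  have e : Matrix.of R * Matrix.of Kn = Matrix.of KnC * Matrix.of Sh := by
    rw [hK]; simp only [Matrix.mul_assoc]; rw [hRS', Matrix.mul_one]
  rw [← ha, Matrix.mulVec_mulVec a, e, hA, Matrix.mulVec_mulVec]
  simp only [← Matrix.mul_assoc]
  rw [ho', Matrix.one_mul]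
  simp only [Matrix.mul_assoc]
  rw [← Matrix.mulVec_mulVec, Matrix.mulVec_diagonal, hc, zero_mul]

lemma measurable_mulVecF {n : ℕ} (A : Fin n → Fin n → ℝ) :
    Measurable (fun v => mulVecF A v) := by
  unfold mulVecF; fun_prop

end PPT

open PPT in
/-- Corollary 7, `cor:fixed_property_theorem_balanced_design_corr`: with
exactly balanced covariates across all groups, a kernel matrix of full rank `r` (the number of
distinct covariate values), and correlated Gaussian noise `ε ~ N(0, σ₀² Σ)`, the discrete and
continuous partial permutation p-values with covariance matrix `Σ` are valid for an arbitrary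
regression function. -/
theorem partial_permutation_valid_balanced_correlated
    {n d H : ℕ} (hn : 1 ≤ n) (hH : 1 ≤ H)
    (X : Fin n → Fin d → ℝ) (Z : Fin n → Fin H)
    -- exactly balanced design: the multiset of covariate values is the same in every group
    (hbal : ∀ h h' : Fin H,
      ((Finset.univ.filter fun i => Z i = h).val.map fun i => X i) =
      ((Finset.univ.filter fun i => Z i = h').val.map fun i => X i))
    -- r is the number of distinct covariate values, and r ≤ n / H
    (r : ℕ) (hr : r = Set.ncard (Set.range fun i => X i)) (hrH : r * H ≤ n)
    -- the true functional relationship, an arbitrary measurable function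
    (f0 : (Fin d → ℝ) → ℝ) (hf0 : Measurable f0)
    -- noise level
    (σ0 : ℝ) (hσ0 : 0 < σ0)
    -- known positive definite covariance structure Σ, with square root Sh = Σ^{1/2} and
    -- inverse square root R = Σ^{-1/2}
    (Sig Sh R : Fin n → Fin n → ℝ)
    (hSig : IsPosDefF Sig) (hSqrt : IsSqrtPair Sig Sh R)
    -- the law of Y = f0(X) + ε with ε ~ N(0, σ₀² Σ), realized as ε = σ₀ Σ^{1/2} g
    (μY : Measure (Fin n → ℝ))
    (hμY : μY = Measure.map
      (fun g : Fin n → ℝ => fun i => f0 (X i) + σ0 * mulVecF Sh g i) (stdGaussianPi n))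
    -- a symmetric positive semidefinite kernel and its sample kernel matrix
    (K : (Fin d → ℝ) → (Fin d → ℝ) → ℝ) (hK : IsPSDKernel K)
    (Kn KnC : Fin n → Fin n → ℝ) (hKn : ∀ i j, Kn i j = K (X i) (X j))
    -- the kernel matrix has full rank r
    (hrank : (Matrix.of Kn).rank = r)
    -- transformed kernel matrix Kₙ^C = Σ^{-1/2} Kₙ Σ^{-1/2}
    (hKnC : KnC = mulF R (mulF Kn R))
    -- a fixed eigendecomposition Kₙ^C = Γ diag(c) Γᵀ
    (Γ : Fin n → Fin n → ℝ) (c : Fin n → ℝ) (hEig : IsEigenDecomp KnC Γ c)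
    -- permutation size
    (b : ℕ) (hb1 : 1 ≤ b) (hb2 : b ≤ n - r)
    -- arbitrary (measurable) test statistic
    (T : (Fin n → Fin d → ℝ) → (Fin n → ℝ) → (Fin n → Fin H) → ℝ)
    (hT : Measurable fun y => T X y Z) :
    -- validity of the p-values, computed from Y^C = Σ^{-1/2} Y
    ∀ α ∈ Set.Ioo (0 : ℝ) 1,
      μY {y | pDisc X Z T Γ b (mulVecF R y) ≤ α} ≤ ENNReal.ofReal α ∧
      μY {y | pCont X Z T Γ b (mulVecF R y) ≤ α} ≤ ENNReal.ofReal α := by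
  intro α hα
  obtain ⟨-, -, hRS, -⟩ := hSqrt
  have hΓ := hEig.1
  let m : Fin n → ℝ := tmulVecF Γ (mulVecF R fun i => f0 (X i))
  let L : (Fin n → ℝ) → (Fin n → ℝ) := fun w i => m i + σ0 * w i
  have hL : Measurable L := by fun_prop
  have hm : ∀ i : Fin n, n - b ≤ (i : ℕ) → m i = 0 := fun i hi =>
    mean_zero X hr f0 K Kn KnC Sh R Γ c hKn hrank hRS hKnC hEig i (by omega)
  let S : (Fin n → ℝ) → ℝ := fun w => T X (mulVecF Γ w) Z
  have hS : Measurable S := hT.comp (measurable_mulVecF Γ)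
  have hprob : IsProbabilityMeasure ((stdGaussianPi n).map L) :=
    Measure.isProbabilityMeasure_map hL.aemeasurable
  have hcancel : ∀ y, mulVecF Γ (tmulVecF Γ y) = y := by
    intro y
    change (Matrix.of Γ).mulVec ((Matrix.of Γ).transpose.mulVec y) = y
    rw [Matrix.mulVec_mulVec, orth_mul hΓ, Matrix.one_mulVec]
  have hRS' : Matrix.of R * Matrix.of Sh = 1 := by
    have h : Matrix.of (mulF R Sh) = Matrix.of (idF n) := by rw [hRS]
    exact h.trans (by ext i j; simp [idF, Matrix.one_apply])
  have hF : Measurable fun y => tmulVecF Γ (mulVecF R y) :=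
    (tmul_inv hΓ).measurable.comp (measurable_mulVecF R)
  have hG : Measurable (fun g : Fin n → ℝ => fun i => f0 (X i) + σ0 * mulVecF Sh g i) := by
    have := measurable_mulVecF Sh
    fun_prop
  have hlin : ∀ g, tmulVecF Γ (mulVecF R (fun i => f0 (X i) + σ0 * mulVecF Sh g i)) =
      L (tmulVecF Γ g) := by
    intro g
    change (Matrix.of Γ).transpose.mulVec ((Matrix.of R).mulVec
      ((fun i => f0 (X i)) + σ0 • (Matrix.of Sh).mulVec g)) =
      (Matrix.of Γ).transpose.mulVec ((Matrix.of R).mulVec fun i => f0 (X i)) +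
        σ0 • (Matrix.of Γ).transpose.mulVec g
    rw [Matrix.mulVec_add, Matrix.mulVec_add, Matrix.mulVec_smul, Matrix.mulVec_smul,
      Matrix.mulVec_mulVec g, hRS', Matrix.one_mulVec]
  have transfer : ∀ A : Set (Fin n → ℝ), MeasurableSet A →
      μY {y | tmulVecF Γ (mulVecF R y) ∈ A} = (stdGaussianPi n).map L A := by
    intro A hA
    have hset : {y | tmulVecF Γ (mulVecF R y) ∈ A} =
      (fun y => tmulVecF Γ (mulVecF R y)) ⁻¹' A := rfl
    rw [hμY, hset, Measure.map_apply hG (hF hA), Measure.map_apply hL hA,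
      ← (tmul_inv hΓ).measure_preimage (hL hA).nullMeasurableSet]
    congr 1
    ext g
    simp only [Set.mem_preimage, Set.mem_ofPred_eq, hlin]
  constructor
  · obtain ⟨h1, h2⟩ := pval_abs ((stdGaussianPi n).map L) (permLaw n b) (permAct n b)
      (inv_affine _ _ (permAct_inv n b) L hL (permAct_affine b σ0 m hm))
      (fun w => ae_of_all _ (permAct_cons n b w)) S hS α hα.1
    rw [← transfer _ h1] at h2
    convert h2 using 3
    ext y
    simp only [Set.mem_ofPred_eq]
    change _ ↔ ((permLaw n b) {ψ | S (tmulVecF Γ (mulVecF R y)) ≤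
      S ((tmulVecF Γ (mulVecF R y)) ∘ ψ.1)}).toReal ≤ α
    rw [permLaw_eq n b (fun ψ => S (tmulVecF Γ (mulVecF R y)) ≤
      S ((tmulVecF Γ (mulVecF R y)) ∘ ψ))]
    simp only [S, hcancel, pDisc]
  · obtain ⟨h1, h2⟩ := pval_abs ((stdGaussianPi n).map L) (stdGaussianPi n) (wStar b)
      (inv_affine _ _ (wStar_inv hn b hb1) L hL (wStar_affine b σ0 hσ0 m hm))
      (wStar_cons hn b hb1) S hS α hα.1
    rw [← transfer _ h1] at h2
    convert h2 using 3
    ext y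
    simp only [S, pCont, Set.mem_ofPred_eq, hcancel]
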